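/- Let P, Q : [0,1] → ℝ² be continuous curves and let p ≥ 1 be a real number. Then the infimum, over all continuous curves M : [0,1] → ℝ², of d_F(P, M)^p + d_F(M, Q)^p equals 2^(1−p) · d_F(P, Q)^p. -/

import Mathlib

/-- A reparameterization: a continuous, non-decreasing map of `[0,1]` to itself
fixing the endpoints. -/
def IsReparam (α : ℝ → ℝ) : Prop :=
  ContinuousOn α (Set.Icc 0 1) ∧ MonotoneOn α (Set.Icc 0 1) ∧
    Set.MapsTo α (Set.Icc 0 1) (Set.Icc 0 1) ∧ α 0 = 0 ∧ α 1 = 1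

/-- The Fréchet distance between two curves `P, Q : [0,1] → ℝ²`. -/
noncomputable def frechetDist (P Q : ℝ → EuclideanSpace ℝ (Fin 2)) : ℝ :=
  sInf { r : ℝ | ∃ α β : ℝ → ℝ, IsReparam α ∧ IsReparam β ∧
    r = ⨆ t : Set.Icc (0 : ℝ) 1, dist (P (α t.1)) (Q (β t.1)) }

theorem IsReparam.id : IsReparam id :=
  ⟨continuousOn_id, monotoneOn_id, Set.mapsTo_id _, rfl, rfl⟩

theorem IsReparam.comp {α β : ℝ → ℝ} (hα : IsReparam α) (hβ : IsReparam β) :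
    IsReparam (α ∘ β) := by
  obtain ⟨hαc, hαm, hαI, hα0, hα1⟩ := hα
  obtain ⟨hβc, hβm, hβI, hβ0, hβ1⟩ := hβ
  refine ⟨hαc.comp hβc hβI, hαm.comp hβm hβI, hαI.comp hβI, ?_, ?_⟩
  · simp [hβ0, hα0]
  · simp [hβ1, hα1]

/-- A strictly increasing reparameterization has a right inverse reparameterization. -/
theorem IsReparam.exists_rightInverse {β : ℝ → ℝ} (hβ : IsReparam β)
    (hs : StrictMonoOn β (Set.Icc 0 1)) :
    ∃ γ : ℝ → ℝ, IsReparam γ ∧ ∀ t ∈ Set.Icc (0 : ℝ) 1, β (γ t) = t := by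
  obtain ⟨hc, -, hI, h0, h1⟩ := hβ
  have hmono : StrictMono (hI.restrict β _ _) := fun a b hab => hs a.2 b.2 hab
  have hsurj : Function.Surjective (hI.restrict β _ _) := by
    rintro ⟨y, hy⟩
    have hy' : y ∈ Set.Icc (β 0) (β 1) := by rwa [h0, h1]
    obtain ⟨x, hx, hxy⟩ := intermediate_value_Icc zero_le_one hc hy'
    exact ⟨⟨x, hx⟩, Subtype.ext hxy⟩
  let e := hmono.orderIsoOfSurjective _ hsurj
  have he : ∀ t, β (e.symm t) = t := fun t => congrArg Subtype.val (e.apply_symm_apply t)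
  have hγ : ∀ t ∈ Set.Icc (0 : ℝ) 1,
      β (e.symm (Set.projIcc 0 1 zero_le_one t)) = t := fun t ht => by
    rw [he, Set.projIcc_of_mem _ ht]
  refine ⟨fun t => e.symm (Set.projIcc 0 1 zero_le_one t), ⟨?_, ?_, ?_, ?_, ?_⟩, hγ⟩
  · exact (continuous_subtype_val.comp
      (e.symm.continuous.comp continuous_projIcc)).continuousOn
  · exact fun a _ b _ hab => e.symm.monotone (Set.monotone_projIcc _ hab)
  · exact fun t _ => (e.symm _).2
  · refine hs.injOn (e.symm _).2 (Set.left_mem_Icc.2 zero_le_one) ?_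
    rw [h0]
    exact hγ 0 (Set.left_mem_Icc.2 zero_le_one)
  · refine hs.injOn (e.symm _).2 (Set.right_mem_Icc.2 zero_le_one) ?_
    rw [h1]
    exact hγ 1 (Set.right_mem_Icc.2 zero_le_one)

/-- Reparameterizations are uniform limits of strictly increasing ones. -/
theorem IsReparam.exists_strictMonoOn_near {β : ℝ → ℝ} (hβ : IsReparam β) {δ : ℝ}
    (hδ : 0 < δ) :
    ∃ β' : ℝ → ℝ, IsReparam β' ∧ StrictMonoOn β' (Set.Icc 0 1) ∧
      ∀ t ∈ Set.Icc (0 : ℝ) 1, dist (β t) (β' t) < δ := by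
  obtain ⟨hc, hm, hI, h0, h1⟩ := hβ
  obtain ⟨η, hη, hη'⟩ := exists_between (lt_min hδ one_pos)
  obtain ⟨hηδ, hη1⟩ := lt_min_iff.1 hη'
  have hs : StrictMonoOn (fun t => (1 - η) * β t + η * t) (Set.Icc 0 1) := by
    intro a ha b hb hab
    have h := mul_le_mul_of_nonneg_left (hm ha hb hab.le) (sub_nonneg.2 hη1.le)
    have h' := mul_lt_mul_of_pos_left hab hη
    exact add_lt_add_of_le_of_lt h h'
  refine ⟨fun t => (1 - η) * β t + η * t,
    ⟨by fun_prop, hs.monotoneOn, fun t ht => ?_, by simp [h0], by simp [h1]⟩, hs,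
    fun t ht => ?_⟩
  · exact convex_Icc (0 : ℝ) 1 (hI ht) ht (sub_nonneg.2 hη1.le) hη.le (by ring)
  · have hd : |β t - t| ≤ 1 := by
      obtain ⟨hβ0, hβ1⟩ := hI ht
      obtain ⟨ht0, ht1⟩ := ht
      exact abs_le.2 ⟨by linarith, by linarith⟩
    calc dist (β t) ((1 - η) * β t + η * t) = η * |β t - t| := by
          rw [Real.dist_eq, ← abs_of_pos hη, ← abs_mul, abs_of_pos hη]
          ring_nf
      _ ≤ η := mul_le_of_le_one_right hη.le hd
      _ < δ := hηδ

theorem frechetDist_nonneg (P Q : ℝ → EuclideanSpace ℝ (Fin 2)) : 0 ≤ frechetDist P Q := by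
  refine Real.sInf_nonneg ?_
  rintro _ ⟨α, β, -, -, rfl⟩
  exact Real.iSup_nonneg fun _ => dist_nonneg

theorem frechetDist_le {P Q : ℝ → EuclideanSpace ℝ (Fin 2)} {α β : ℝ → ℝ} {c : ℝ}
    (hα : IsReparam α) (hβ : IsReparam β)
    (h : ∀ t ∈ Set.Icc (0 : ℝ) 1, dist (P (α t)) (Q (β t)) ≤ c) : frechetDist P Q ≤ c := by
  refine csInf_le_of_le ⟨0, ?_⟩ ⟨α, β, hα, hβ, rfl⟩ (ciSup_le fun t => h t.1 t.2)
  rintro _ ⟨α, β, -, -, rfl⟩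
  exact Real.iSup_nonneg fun _ => dist_nonneg

theorem dist_le_iSup_of_isReparam {P Q : ℝ → EuclideanSpace ℝ (Fin 2)}
    (hP : ContinuousOn P (Set.Icc 0 1)) (hQ : ContinuousOn Q (Set.Icc 0 1)) {α β : ℝ → ℝ}
    (hα : IsReparam α) (hβ : IsReparam β) {t : ℝ} (ht : t ∈ Set.Icc (0 : ℝ) 1) :
    dist (P (α t)) (Q (β t)) ≤
      ⨆ t : Set.Icc (0 : ℝ) 1, dist (P (α t.1)) (Q (β t.1)) := by
  have hc : ContinuousOn (fun t => dist (P (α t)) (Q (β t))) (Set.Icc 0 1) :=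
    continuous_dist.comp_continuousOn
      ((hP.comp hα.1 hα.2.2.1).prodMk (hQ.comp hβ.1 hβ.2.2.1))
  have hb := isCompact_Icc.bddAbove_image hc
  rw [Set.image_eq_range] at hb
  exact le_ciSup hb ⟨t, ht⟩

theorem frechetDist_comm (P Q : ℝ → EuclideanSpace ℝ (Fin 2)) :
    frechetDist P Q = frechetDist Q P := by
  unfold frechetDist
  congr 1
  ext r
  constructor <;>
  · rintro ⟨α, β, hα, hβ, rfl⟩
    exact ⟨β, α, hβ, hα, by simp only [dist_comm]⟩

/-- Up to an arbitrarily small error, only one of the two curves has to be reparameterized. -/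
theorem exists_isReparam_dist_lt {P M : ℝ → EuclideanSpace ℝ (Fin 2)}
    (hP : ContinuousOn P (Set.Icc 0 1)) (hM : ContinuousOn M (Set.Icc 0 1)) {ε : ℝ}
    (hε : 0 < ε) :
    ∃ α : ℝ → ℝ, IsReparam α ∧
      ∀ t ∈ Set.Icc (0 : ℝ) 1, dist (P (α t)) (M t) < frechetDist P M + ε := by
  obtain ⟨_, ⟨α, β, hα, hβ, rfl⟩, hr⟩ := Real.lt_sInf_add_pos
    (s := { r : ℝ | ∃ α β : ℝ → ℝ, IsReparam α ∧ IsReparam β ∧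
      r = ⨆ t : Set.Icc (0 : ℝ) 1, dist (P (α t.1)) (M (β t.1)) })
    ⟨_, id, id, .id, .id, rfl⟩ (half_pos hε)
  obtain ⟨δ, hδ, hMδ⟩ := Metric.uniformContinuousOn_iff.1
    (isCompact_Icc.uniformContinuousOn_of_continuous hM) _ (half_pos hε)
  obtain ⟨β', hβ', hs, hnear⟩ := hβ.exists_strictMonoOn_near hδ
  obtain ⟨γ, hγ, hinv⟩ := hβ'.exists_rightInverse hs
  refine ⟨α ∘ γ, hα.comp hγ, fun t ht => ?_⟩
  have hγt := hγ.2.2.1 ht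
  have h₁ := dist_le_iSup_of_isReparam hP hM hα hβ hγt
  have h₂ := hMδ _ (hβ.2.2.1 hγt) _ (hβ'.2.2.1 hγt) (hnear _ hγt)
  rw [hinv t ht] at h₂
  calc dist (P (α (γ t))) (M t)
      ≤ dist (P (α (γ t))) (M (β (γ t))) + dist (M (β (γ t))) (M t) := dist_triangle _ _ _
    _ < (frechetDist P M + ε / 2) + ε / 2 := add_lt_add (h₁.trans_lt hr) h₂
    _ = frechetDist P M + ε := by ring

theorem frechetDist_triangle {P M Q : ℝ → EuclideanSpace ℝ (Fin 2)}
    (hP : ContinuousOn P (Set.Icc 0 1)) (hM : ContinuousOn M (Set.Icc 0 1))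
    (hQ : ContinuousOn Q (Set.Icc 0 1)) :
    frechetDist P Q ≤ frechetDist P M + frechetDist M Q := by
  refine le_of_forall_pos_le_add fun ε hε => ?_
  obtain ⟨α, hα, hPM⟩ := exists_isReparam_dist_lt hP hM (half_pos hε)
  obtain ⟨β, hβ, hQM⟩ := exists_isReparam_dist_lt hQ hM (half_pos hε)
  refine frechetDist_le hα hβ fun t ht => ?_
  have h := dist_triangle_right (P (α t)) (Q (β t)) (M t)
  have h₁ := hPM t ht
  have h₂ := hQM t ht
  rw [frechetDist_comm Q M] at h₂
  linarith

/-- The midpoint curve of two reparameterized curves halves their distance. -/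
theorem exists_frechetDist_le_half {P Q : ℝ → EuclideanSpace ℝ (Fin 2)}
    (hP : ContinuousOn P (Set.Icc 0 1)) (hQ : ContinuousOn Q (Set.Icc 0 1)) {α β : ℝ → ℝ}
    (hα : IsReparam α) (hβ : IsReparam β) {r : ℝ}
    (h : ∀ t ∈ Set.Icc (0 : ℝ) 1, dist (P (α t)) (Q (β t)) ≤ r) :
    ∃ M : ℝ → EuclideanSpace ℝ (Fin 2), ContinuousOn M (Set.Icc 0 1) ∧
      frechetDist P M ≤ r / 2 ∧ frechetDist M Q ≤ r / 2 := by
  have hPα := hP.comp hα.1 hα.2.2.1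
  have hQβ := hQ.comp hβ.1 hβ.2.2.1
  refine ⟨fun t => midpoint ℝ (P (α t)) (Q (β t)), ?_, frechetDist_le hα .id fun t ht => ?_,
    frechetDist_le .id hβ fun t ht => ?_⟩
  · simp only [midpoint_eq_smul_add]
    exact ContinuousOn.const_smul (hPα.add hQβ) (⅟2 : ℝ)
  · have := h t ht
    simp only [id, dist_left_midpoint, Real.norm_ofNat]
    linarith
  · have := h t ht
    simp only [id, dist_midpoint_right, Real.norm_ofNat]
    linarith

/-- The optimal unrestricted p-mean curve of two curves has cost exactly
`2^(1-p)` times the p-th power of their Fréchet distance. -/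
theorem pMean_two_curves (P Q : ℝ → EuclideanSpace ℝ (Fin 2))
    (hP : ContinuousOn P (Set.Icc 0 1)) (hQ : ContinuousOn Q (Set.Icc 0 1))
    (p : ℝ) (hp : 1 ≤ p) :
    sInf { c : ℝ | ∃ M : ℝ → EuclideanSpace ℝ (Fin 2),
        ContinuousOn M (Set.Icc 0 1) ∧
        c = frechetDist P M ^ p + frechetDist M Q ^ p }
      = 2 ^ (1 - p) * frechetDist P Q ^ p := by
  have hp0 : 0 ≤ p := zero_le_one.trans hp
  have hconst : (2 : ℝ) ^ (1 - p) * 2 ^ (p - 1) = 1 := by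
    rw [← Real.rpow_add two_pos]
    simp
  refine le_antisymm ?_ (le_csInf ⟨_, P, hP, rfl⟩ ?_)
  · have hclosed : IsClosed {r : ℝ | sInf { c : ℝ | ∃ M : ℝ → EuclideanSpace ℝ (Fin 2),
        ContinuousOn M (Set.Icc 0 1) ∧
        c = frechetDist P M ^ p + frechetDist M Q ^ p } ≤ 2 ^ (1 - p) * r ^ p} :=
      isClosed_le continuous_const
        (continuous_const.mul (Real.continuous_rpow_const hp0))
    refine closure_minimal ?_ hclosed (csInf_mem_closure ⟨_, id, id, .id, .id, rfl⟩ ⟨0, ?_⟩)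
    · rintro r ⟨α, β, hα, hβ, hr⟩
      obtain ⟨M, hM, hPM, hMQ⟩ := exists_frechetDist_le_half hP hQ hα hβ
        fun t ht => (dist_le_iSup_of_isReparam hP hQ hα hβ ht).trans hr.ge
      have hr0 : 0 ≤ r := hr ▸ Real.iSup_nonneg fun _ => dist_nonneg
      have hbdd : BddBelow { c : ℝ | ∃ M : ℝ → EuclideanSpace ℝ (Fin 2),
          ContinuousOn M (Set.Icc 0 1) ∧
          c = frechetDist P M ^ p + frechetDist M Q ^ p } := by
        refine ⟨0, ?_⟩
        rintro _ ⟨M, -, rfl⟩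
        have := frechetDist_nonneg P M
        have := frechetDist_nonneg M Q
        positivity
      refine (csInf_le hbdd ⟨M, hM, rfl⟩).trans ?_
      calc frechetDist P M ^ p + frechetDist M Q ^ p ≤ (r / 2) ^ p + (r / 2) ^ p :=
            add_le_add (Real.rpow_le_rpow (frechetDist_nonneg P M) hPM hp0)
              (Real.rpow_le_rpow (frechetDist_nonneg M Q) hMQ hp0)
        _ = 2 ^ (1 - p) * r ^ p := by
            rw [Real.div_rpow hr0 two_pos.le, Real.rpow_sub two_pos, Real.rpow_one]
            ring
    · rintro _ ⟨α, β, -, -, rfl⟩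
      exact Real.iSup_nonneg fun _ => dist_nonneg
  · rintro _ ⟨M, hM, rfl⟩
    have hPM := frechetDist_nonneg P M
    have hMQ := frechetDist_nonneg M Q
    calc 2 ^ (1 - p) * frechetDist P Q ^ p
        ≤ 2 ^ (1 - p) * (frechetDist P M + frechetDist M Q) ^ p := by
          gcongr
          · exact frechetDist_nonneg P Q
          · exact frechetDist_triangle hP hM hQ
      _ ≤ 2 ^ (1 - p) * (2 ^ (p - 1) * (frechetDist P M ^ p + frechetDist M Q ^ p)) := by
          gcongr
          exact mod_cast NNReal.rpow_add_le_mul_rpow_add_rpow ⟨_, hPM⟩ ⟨_, hMQ⟩ hp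
      _ = frechetDist P M ^ p + frechetDist M Q ^ p := by
          rw [← mul_assoc, hconst, one_mul]
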